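/- arXiv:math/0501185 — 3 statements merged into one kernel-verified Lean document; each statement's English description precedes it below -/
import Mathlib

section
/- Let μ be an admissible probability measure on ℝ with second characteristic ψ, and let Λ(μ) = {t > 0 : exp(tψ) is the characteristic function of some probability measure on ℝ}. If for every λ > 0 there exists t ∈ Λ(μ) with t < λ (i.e., Λ(μ) is not bounded away from 0), then Λ(μ) = (0,∞), i.e., μ is infinitely divisible. Equivalently: either Λ(μ) = (0,∞), or there exists λ > 0 with Λ(μ) ⊆ [λ,∞). -/
open MeasureTheory

/-- The characteristic function of a measure on `ℝ`. -/
noncomputable def charFunR (μ : Measure ℝ) (y : ℝ) : ℂ :=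
  ∫ x, Complex.exp (Complex.I * y * x) ∂μ

/-- `Λ(μ)` for an admissible measure with second characteristic `ψ`:
the set of `t > 0` such that `exp (t ψ)` is a characteristic function. -/
def Lam (ψ : ℝ → ℂ) : Set ℝ :=
  {t | 0 < t ∧ ∃ ν : Measure ℝ, IsProbabilityMeasure ν ∧
    ∀ y, charFunR ν y = Complex.exp (t * ψ y)}

open Filter Topology

/-- **Lévy's continuity theorem**, existence part: a pointwise limit of characteristic functions
of probability measures which is continuous at `0` is the characteristic function of a probability
measure. -/
theorem exists_charFun_eq_of_tendsto {E : Type*} [NormedAddCommGroup E] [InnerProductSpace ℝ E]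
    [FiniteDimensional ℝ E] [MeasurableSpace E] [BorelSpace E]
    {μ : ℕ → ProbabilityMeasure E} {f : E → ℂ} (hf : ContinuousAt f 0)
    (h : ∀ y, Tendsto (fun n ↦ charFun (μ n : Measure E) y) atTop (𝓝 (f y))) :
    ∃ ν : ProbabilityMeasure E, ∀ y, charFun (ν : Measure E) y = f y := by
  have h_tight : IsTightMeasureSet (Set.range fun n ↦ (μ n : Measure E)) :=
    isTightMeasureSet_of_tendsto_charFun hf h
  have h_compact : IsCompact (closure (Set.range μ)) := by
    refine isCompact_closure_of_isTightMeasureSet (h_tight.subset ?_)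
    rintro _ ⟨_, ⟨n, rfl⟩, rfl⟩
    exact ⟨n, rfl⟩
  let U : Ultrafilter ℕ := Ultrafilter.of atTop
  have hU : (U : Filter ℕ) ≤ atTop := Ultrafilter.of_le atTop
  obtain ⟨ν, -, hν⟩ := h_compact.ultrafilter_le_nhds (U.map μ)
    (.trans (by simp) (principal_mono.mpr subset_closure))
  have hν' : Tendsto μ U (𝓝 ν) := hν
  refine ⟨ν, fun y ↦ tendsto_nhds_unique ?_ ((h y).mono_left hU)⟩
  rw [ProbabilityMeasure.tendsto_iff_forall_integral_rclike_tendsto ℂ] at hν'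
  simp_rw [charFun_eq_integral_innerProbChar]
  exact hν' (BoundedContinuousFunction.innerProbChar y)

theorem charFunR_eq_charFun (μ : Measure ℝ) (y : ℝ) : charFunR μ y = charFun μ y := by
  rw [charFunR, charFun_apply_real]
  congr with x
  ring_nf

theorem mem_Lam_iff {ψ : ℝ → ℂ} {t : ℝ} :
    t ∈ Lam ψ ↔ 0 < t ∧ ∃ ν : ProbabilityMeasure ℝ,
      ∀ y, charFun (ν : Measure ℝ) y = Complex.exp (t * ψ y) := by
  simp only [Lam, Set.mem_ofPred_eq, charFunR_eq_charFun]
  exact and_congr_right fun _ ↦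
    ⟨fun ⟨ν, hν, h⟩ ↦ ⟨⟨ν, hν⟩, h⟩, fun ⟨ν, h⟩ ↦ ⟨ν, inferInstance, h⟩⟩

theorem add_mem_Lam {ψ : ℝ → ℂ} {s t : ℝ} (hs : s ∈ Lam ψ) (ht : t ∈ Lam ψ) :
    s + t ∈ Lam ψ := by
  rw [mem_Lam_iff] at *
  obtain ⟨hs, ν, hν⟩ := hs
  obtain ⟨ht, ρ, hρ⟩ := ht
  refine ⟨add_pos hs ht, ⟨(ν : Measure ℝ) ∗ (ρ : Measure ℝ), inferInstance⟩, fun y ↦ ?_⟩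
  rw [ProbabilityMeasure.coe_mk, charFun_conv, hν, hρ, ← Complex.exp_add]
  push_cast
  ring_nf

theorem natCast_mul_mem_Lam {ψ : ℝ → ℂ} {t : ℝ} (ht : t ∈ Lam ψ) {n : ℕ} (hn : 0 < n) :
    n * t ∈ Lam ψ := by
  induction n, hn using Nat.le_induction with
  | base => simpa using ht
  | succ n _ ih => simpa [add_mul] using add_mem_Lam ih ht

/-- `Λ(μ)` is closed in `(0,∞)`. -/
theorem mem_Lam_of_tendsto {ψ : ℝ → ℂ} (hψ : Continuous ψ) {u : ℕ → ℝ} {s : ℝ} (hs : 0 < s)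
    (hu : ∀ n, u n ∈ Lam ψ) (hus : Tendsto u atTop (𝓝 s)) : s ∈ Lam ψ := by
  simp only [mem_Lam_iff] at hu ⊢
  choose _ ν hν using hu
  refine ⟨hs, exists_charFun_eq_of_tendsto (μ := ν) (by fun_prop) fun y ↦ ?_⟩
  simp_rw [hν]
  exact (((Complex.continuous_ofReal.tendsto s).comp hus).mul_const (ψ y)).cexp

/-- If `Λ(μ)` is not bounded away from `0`, then `Λ(μ) = (0,∞)`, i.e. `μ` is
infinitely divisible. Equivalently: either `Λ(μ) = (0,∞)` or `Λ(μ) ⊆ [λ,∞)`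
for some `λ > 0`. -/
theorem Lam_not_bounded_away_from_zero (μ : Measure ℝ) [IsProbabilityMeasure μ]
    (ψ : ℝ → ℂ) (hψc : Continuous ψ) (hψ0 : ψ 0 = 0)
    (hμψ : ∀ y, charFunR μ y = Complex.exp (ψ y))
    (h : ∀ lam > (0 : ℝ), ∃ t ∈ Lam ψ, t < lam) :
    Lam ψ = Set.Ioi (0 : ℝ) := by
  refine Set.Subset.antisymm (fun t ht ↦ ht.1) fun s (hs : 0 < s) ↦ ?_
  choose t ht htlt using fun n : ℕ ↦ h (1 / ((n : ℝ) + 1)) Nat.one_div_pos_of_nat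
  have hpos n : 0 < t n := (ht n).1
  have ht0 : Tendsto t atTop (𝓝 0) :=
    squeeze_zero (fun n ↦ (hpos n).le) (fun n ↦ (htlt n).le) tendsto_one_div_add_atTop_nhds_zero_nat
  refine mem_Lam_of_tendsto hψc hs
    (fun n ↦ natCast_mul_mem_Lam (ht n) (Nat.ceil_pos.mpr (div_pos hs (hpos n)))) ?_
  refine tendsto_of_tendsto_of_tendsto_of_le_of_le (g := fun _ ↦ s) (h := fun n ↦ s + t n)
    tendsto_const_nhds (by simpa using ht0.const_add s) (fun n ↦ ?_) (fun n ↦ ?_)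
  · exact (div_le_iff₀ (hpos n)).mp (Nat.le_ceil _)
  · have := (Nat.ceil_lt_add_one (div_pos hs (hpos n)).le).le
    calc (⌈s / t n⌉₊ : ℝ) * t n ≤ (s / t n + 1) * t n := by gcongr; exact (hpos n).le
      _ = s + t n := by field_simp [(hpos n).ne']
end

section
/- Let μ be a probability measure on ℤ whose characteristic function μ̂ is nonvanishing on 𝕋, let φ : [0,1] → ℂ be a continuous function with φ(0) = 0 and μ̂(e^{2πis}) = exp(φ(s)) for all s ∈ [0,1], and let w = (φ(1) − φ(0))/(2πi) ∈ ℤ be the winding number of μ̂ around 0; assume w ≠ 0 (i.e., μ is not admissible). If m, n are coprime positive integers and ν is a probability measure on ℤ with (ν̂(z))ⁿ = (μ̂(z))ᵐ for all z ∈ 𝕋, then n divides w. (Theorem 3.1(i) for G = ℤ.) -/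
open MeasureTheory

/-- The characteristic function of a measure `μ` on `ℤ`, as a function on the
unit circle: `μ̂(z) = ∑_{k ∈ ℤ} μ({k}) z^k = ∫ z^k dμ(k)`. -/
noncomputable def charFunZ (μ : Measure ℤ) (z : Circle) : ℂ :=
  ∫ k, (z : ℂ) ^ k ∂μ

/-- The characteristic function of a finite measure on `ℤ` is continuous. -/
theorem continuous_charFunZ (ν : Measure ℤ) [IsFiniteMeasure ν] : Continuous (charFunZ ν) := by
  refine continuous_of_dominated (bound := fun _ ↦ 1) (fun z ↦ ?_) (fun z ↦ ?_)
    (integrable_const _) (.of_forall fun k ↦ ?_)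
  · exact (measurable_of_countable _).aestronglyMeasurable
  · exact .of_forall fun k ↦ by simp [norm_zpow, Circle.norm_coe]
  · exact continuous_subtype_val.zpow₀ k fun z ↦ Or.inl (Circle.coe_ne_zero z)

/-- A continuous function on a preconnected set all of whose values have `n`-th power `1` is
constant. -/
theorem IsPreconnected.eq_of_pow_eq_one {X R : Type*} [TopologicalSpace X] [CommRing R]
    [IsDomain R] [TopologicalSpace R] [T1Space R] {S : Set X} (hS : IsPreconnected S)
    {f : X → R} (hf : ContinuousOn f S) {n : ℕ} (hn : 0 < n) (hpow : ∀ x ∈ S, f x ^ n = 1)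
    {x y : X} (hx : x ∈ S) (hy : y ∈ S) : f x = f y := by
  have hfin : {a : R | a ^ n = 1}.Finite := by
    refine (Polynomial.nthRootsFinset n (1 : R)).finite_toSet.subset fun a ha ↦ ?_
    exact (Polynomial.mem_nthRootsFinset hn 1).2 ha
  exact hS.constant_of_mapsTo hfin.isDiscrete hf hpow hx hy

/-- Theorem 3.1(i) for `G = ℤ`: if `μ̂` is nonvanishing with nonzero winding
number `w` around `0` (so `μ` is not admissible), and `ν̂ⁿ = μ̂ᵐ` for a
characteristic function `ν̂` with `m, n` coprime, then `n ∣ w`. -/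
theorem winding_number_divides (μ : Measure ℤ) [IsProbabilityMeasure μ]
    (hnz : ∀ z : Circle, charFunZ μ z ≠ 0)
    (φ : ℝ → ℂ) (hφc : ContinuousOn φ (Set.Icc 0 1)) (hφ0 : φ 0 = 0)
    (hφ : ∀ s ∈ Set.Icc (0 : ℝ) 1,
      charFunZ μ (Circle.exp (2 * Real.pi * s)) = Complex.exp (φ s))
    (w : ℤ) (hw : φ 1 - φ 0 = 2 * Real.pi * Complex.I * w) (hw0 : w ≠ 0)
    (m n : ℕ) (hm : 0 < m) (hn : 0 < n) (hmn : Nat.Coprime m n)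
    (ν : Measure ℤ) [IsProbabilityMeasure ν]
    (hν : ∀ z, (charFunZ ν z) ^ n = (charFunZ μ z) ^ m) :
    (n : ℤ) ∣ w := by
  have hn0 : (n : ℂ) ≠ 0 := by exact_mod_cast hn.ne'
  let e : ℝ → Circle := fun s ↦ Circle.exp (2 * Real.pi * s)
  let f : ℝ → ℂ := fun s ↦ charFunZ ν (e s) * Complex.exp (-(m * φ s / n))
  have hfc : ContinuousOn f (Set.Icc 0 1) := by
    have he : Continuous e := by fun_prop
    refine ((continuous_charFunZ ν).comp he).continuousOn.mul ?_
    exact ((continuousOn_const.mul hφc).div_const _).neg.cexp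
  have hpow : ∀ s ∈ Set.Icc (0 : ℝ) 1, f s ^ n = 1 := by
    intro s hs
    have hexp : (n : ℂ) * -(m * φ s / n) = -(m * φ s) := by field_simp
    simp only [f, e]
    rw [mul_pow, hν, hφ s hs, ← Complex.exp_nat_mul, ← Complex.exp_nat_mul, hexp,
      ← Complex.exp_add, add_neg_cancel, Complex.exp_zero]
  have hf01 : f 0 = f 1 :=
    isPreconnected_Icc.eq_of_pow_eq_one hfc hn hpow (by simp) (by simp)
  have he0 : e 0 = 1 := by simp [e]
  have he1 : e 1 = 1 := by simp [e]
  have hν1 : charFunZ ν 1 ≠ 0 := by simp [charFunZ]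
  have hexp : Complex.exp (m * φ 1 / n) = 1 := by
    simp only [f, he0, he1, hφ0] at hf01
    have h := mul_left_cancel₀ hν1 hf01
    rw [Complex.exp_neg (m * φ 1 / n)] at h
    simpa using h.symm
  obtain ⟨k, hk⟩ := Complex.exp_eq_one_iff.1 hexp
  rw [hφ0, sub_zero] at hw
  rw [hw, div_eq_iff hn0] at hk
  have hmk : (m : ℤ) * w = n * k := by
    have h : (m * w : ℂ) = n * k := by
      refine mul_right_cancel₀ Complex.two_pi_I_ne_zero ?_
      linear_combination hk
    exact_mod_cast h
  exact (Nat.isCoprime_iff_coprime.2 hmn.symm).dvd_of_dvd_mul_left ⟨k, hmk⟩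
end

section
/- Let μ be a probability measure on ℝ whose characteristic function μ̂ is three times continuously differentiable in a neighborhood of 0 and which has at least one zero. Let m, n be coprime positive integers and set t = m/n. If there exists a probability measure ν on ℝ with (ν̂(y))ⁿ = (μ̂(y))ᵐ for all y ∈ ℝ, then for every γ₀ ∈ ℝ with μ̂(γ₀) = 0 and every smooth path α : (−1,1) → ℝ with α(0) = γ₀, one has limsup_{s→0⁺} |μ̂(α(s))|^t / s < ∞. (Theorem 3.2: Λ^alg(μ) is bounded below by t₀(μ).) -/
open MeasureTheory

theorem integrable_exp_I_mul (μ : Measure ℝ) [IsFiniteMeasure μ] (y : ℝ) :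
    Integrable (fun x : ℝ => Complex.exp (Complex.I * y * x)) μ := by
  refine Integrable.of_bound (by fun_prop) 1 (ae_of_all _ fun x => ?_)
  rw [show Complex.I * y * x = ((y * x : ℝ) : ℂ) * Complex.I by push_cast; ring,
    Complex.norm_exp_ofReal_mul_I]

theorem charFunR_zero (μ : Measure ℝ) [IsProbabilityMeasure μ] : charFunR μ 0 = 1 := by
  simp [charFunR]

theorem norm_charFunR_le_one (μ : Measure ℝ) [IsProbabilityMeasure μ] (y : ℝ) :
    ‖charFunR μ y‖ ≤ 1 := by
  have h := norm_integral_le_of_norm_le_const (μ := μ) (C := 1)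
    (f := fun x : ℝ => Complex.exp (Complex.I * y * x)) (ae_of_all _ fun x => by
      rw [show Complex.I * y * x = ((y * x : ℝ) : ℂ) * Complex.I by push_cast; ring,
        Complex.norm_exp_ofReal_mul_I])
  simpa [charFunR] using h

theorem sq_integral_le_integral_sq {μ : Measure ℝ} [IsProbabilityMeasure μ] {X : ℝ → ℝ}
    (hX : Integrable X μ) (hX2 : Integrable (fun x => X x ^ 2) μ) :
    (∫ x, X x ∂μ) ^ 2 ≤ ∫ x, X x ^ 2 ∂μ := by
  set M := ∫ x, X x ∂μ with hM
  have h : 0 ≤ ∫ x, (X x - M) ^ 2 ∂μ := integral_nonneg fun x => sq_nonneg _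
  have e : ∀ x, (X x - M) ^ 2 = X x ^ 2 - (2 * M) * X x + M ^ 2 := fun x => by ring
  simp only [e] at h
  rw [integral_add (f := fun x => X x ^ 2 - 2 * M * X x) (hX2.sub (hX.const_mul _))
    (integrable_const _), integral_sub hX2 (hX.const_mul _), integral_const_mul, ← hM] at h
  simp only [integral_const, probReal_univ, one_smul] at h
  linarith

/-- Bessel's inequality for the characters `1` and `exp (i γ x)`, orthogonal when `μ̂ γ = 0`. -/
theorem sq_norm_charFunR_add_le (μ : Measure ℝ) [IsProbabilityMeasure μ] {γ : ℝ}
    (hγ : charFunR μ γ = 0) (h : ℝ) :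
    ‖charFunR μ (γ + h)‖ ^ 2 ≤ 1 - ‖charFunR μ h‖ ^ 2 := by
  set a := charFunR μ h with ha
  set e : ℝ → ℝ → ℂ := fun y x => Complex.exp (Complex.I * y * x) with he
  have hnorm (y x : ℝ) : ‖e y x‖ = 1 := by
    simp only [he]
    rw [show Complex.I * y * x = ((y * x : ℝ) : ℂ) * Complex.I by push_cast; ring,
      Complex.norm_exp_ofReal_mul_I]
  have hint (y : ℝ) : Integrable (e y) μ := integrable_exp_I_mul μ y
  have hdiff : Integrable (fun x => e h x - a) μ := (hint h).sub (integrable_const a)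
  have hsq (x : ℝ) : ‖e h x - a‖ ^ 2
      = 1 + ‖a‖ ^ 2 - 2 * ((starRingEnd ℂ) a * e h x).re := by
    have h1 := hnorm h x
    rw [← Complex.normSq_eq_norm_sq, Complex.normSq_sub, Complex.normSq_eq_norm_sq,
      Complex.normSq_eq_norm_sq, h1, mul_comm (e h x)]
    ring
  have hre : Integrable (fun x => ((starRingEnd ℂ) a * e h x).re) μ :=
    ((hint h).const_mul _).re
  have hsqint : Integrable (fun x => ‖e h x - a‖ ^ 2) μ := by
    simp only [hsq]
    exact (integrable_const _).sub (hre.const_mul 2)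
  have hval : ∫ x, ‖e h x - a‖ ^ 2 ∂μ = 1 - ‖a‖ ^ 2 := by
    have hr : ∫ x, ((starRingEnd ℂ) a * e h x).re ∂μ = ‖a‖ ^ 2 := by
      have := integral_re ((hint h).const_mul ((starRingEnd ℂ) a))
      simp only [RCLike.re_to_complex] at this
      rw [this, integral_const_mul, show ∫ x, e h x ∂μ = a from rfl, mul_comm,
        Complex.mul_conj, Complex.ofReal_re, Complex.normSq_eq_norm_sq]
    simp only [hsq]
    rw [integral_sub (integrable_const _) (hre.const_mul 2), integral_const_mul, hr]
    simp only [integral_const, probReal_univ, one_smul]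
    ring
  have hrep : charFunR μ (γ + h) = ∫ x, e γ x * (e h x - a) ∂μ := by
    have hmul (x : ℝ) : e γ x * (e h x - a) = e (γ + h) x - e γ x * a := by
      have : e (γ + h) x = e γ x * e h x := by
        simp only [he, ← Complex.exp_add]
        push_cast
        ring_nf
      rw [this]
      ring
    simp only [hmul]
    rw [integral_sub (hint _) ((hint γ).mul_const a), integral_mul_const,
      show ∫ x, e γ x ∂μ = 0 from hγ, zero_mul, sub_zero]
    rfl
  have hle : ‖charFunR μ (γ + h)‖ ≤ ∫ x, ‖e h x - a‖ ∂μ := by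
    rw [hrep]
    refine (norm_integral_le_integral_norm _).trans_eq ?_
    simp only [norm_mul, hnorm, one_mul]
  calc ‖charFunR μ (γ + h)‖ ^ 2 ≤ (∫ x, ‖e h x - a‖ ∂μ) ^ 2 := by gcongr
    _ ≤ ∫ x, ‖e h x - a‖ ^ 2 ∂μ := sq_integral_le_integral_sq hdiff.norm hsqint
    _ = 1 - ‖a‖ ^ 2 := hval

open Asymptotics Topology in
theorem IsLocalMax.isBigO_sub_sq {g : ℝ → ℝ} {x₀ : ℝ} (hmax : IsLocalMax g x₀)
    (hg : ContDiffAt ℝ 2 g x₀) :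
    (fun x => g x - g x₀) =O[𝓝 x₀] fun x => (x - x₀) ^ 2 := by
  have hd : DifferentiableAt ℝ (deriv g) x₀ :=
    ((hg.fderiv_right (m := 1) (by norm_num)).differentiableAt one_ne_zero).clm_apply
      (differentiableAt_const 1)
  have hev : ∀ᶠ x in 𝓝 x₀, DifferentiableAt ℝ g x :=
    (hg.eventually (by simp)).mono fun x hx => hx.differentiableAt (by simp)
  have hO := hd.isBigO_sub
  simp only [hmax.deriv_eq_zero, sub_zero] at hO
  obtain ⟨C, hC⟩ := hO.bound
  obtain ⟨r, hr, hball⟩ := Metric.eventually_nhds_iff_ball.1 (hev.and hC)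
  refine IsBigO.of_bound |C| (Metric.eventually_nhds_iff_ball.2 ⟨r, hr, fun x hx => ?_⟩)
  have hsub : Metric.closedBall x₀ (dist x x₀) ⊆ Metric.ball x₀ r :=
    Metric.closedBall_subset_ball hx
  have hC0 : ∀ y ∈ Metric.closedBall x₀ (dist x x₀), ‖deriv g y‖ ≤ |C| * ‖x - x₀‖ := by
    intro y hy
    refine (hball y (hsub hy)).2.trans ?_
    have : ‖y - x₀‖ ≤ ‖x - x₀‖ := by simpa [dist_eq_norm] using hy
    gcongr
    exact le_abs_self C
  have := (convex_closedBall x₀ (dist x x₀)).norm_image_sub_le_of_norm_deriv_le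
    (fun y hy => (hball y (hsub hy)).1) hC0
    (Metric.mem_closedBall_self dist_nonneg) (Metric.mem_closedBall.2 le_rfl)
  rw [norm_pow, pow_two, ← mul_assoc]
  exact this

open Asymptotics Topology in
theorem isBigO_one_sub_sq_norm_charFunR (μ : Measure ℝ) [IsProbabilityMeasure μ]
    (hμ : ContDiffAt ℝ 2 (charFunR μ) 0) :
    (fun h => 1 - ‖charFunR μ h‖ ^ 2) =O[𝓝 0] fun h => h ^ 2 := by
  have hmax : IsLocalMax (fun h => ‖charFunR μ h‖ ^ 2) 0 :=
    Filter.Eventually.of_forall fun h => by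
      simpa [charFunR_zero] using norm_charFunR_le_one μ h
  simpa [charFunR_zero] using (hmax.isBigO_sub_sq (hμ.norm_sq ℝ)).neg_left

theorem one_sub_le_mul_one_sub_of_pow_eq_pow {u w : ℝ} {m n : ℕ} (hn : n ≠ 0)
    (hu : 0 ≤ u) (hw : 0 ≤ w) (hw1 : w ≤ 1) (h : w ^ n = u ^ m) :
    1 - w ≤ m * (1 - u) := by
  have h1 : w ^ n ≤ w := pow_le_of_le_one hw hw1 hn
  have h2 := one_add_mul_sub_le_pow (by linarith : -1 ≤ u) m
  linarith

open Asymptotics Topology in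
theorem isBigO_charFunR_sub_of_pow_eq_pow (μ ν : Measure ℝ) [IsProbabilityMeasure μ]
    [IsProbabilityMeasure ν] (hμ : ContDiffAt ℝ 2 (charFunR μ) 0) {m n : ℕ} (hn : n ≠ 0)
    (hν : ∀ y, charFunR ν y ^ n = charFunR μ y ^ m) {γ : ℝ} (hγ : charFunR ν γ = 0) :
    charFunR ν =O[𝓝 γ] fun y => y - γ := by
  have hbound (h : ℝ) : ‖charFunR ν (γ + h)‖ ^ 2 ≤ m * (1 - ‖charFunR μ h‖ ^ 2) := by
    refine (sq_norm_charFunR_add_le ν hγ h).trans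
      (one_sub_le_mul_one_sub_of_pow_eq_pow hn (by positivity) (by positivity)
        (pow_le_one₀ (norm_nonneg _) (norm_charFunR_le_one ν h)) ?_)
    rw [← pow_mul, ← pow_mul, mul_comm 2 n, mul_comm 2 m, pow_mul, pow_mul, ← norm_pow, hν h,
      norm_pow]
  have h0 : (fun h => ‖charFunR ν (γ + h)‖ ^ 2) =O[𝓝 0] fun h => h ^ 2 :=
    (IsBigO.of_bound' (Filter.Eventually.of_forall fun h => by
      rw [Real.norm_of_nonneg (by positivity)]
      exact (hbound h).trans (le_abs_self _))).trans
      ((isBigO_one_sub_sq_norm_charFunR μ hμ).const_mul_left m)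
  have h1 : (fun h => charFunR ν (γ + h)) =O[𝓝 0] fun h => h :=
    (h0.of_pow two_ne_zero).of_norm_left
  have ht : Filter.Tendsto (fun y => y - γ) (𝓝 γ) (𝓝 0) :=
    (continuous_sub_right γ).tendsto' γ 0 (sub_self γ)
  simpa [Function.comp_def] using h1.comp_tendsto ht

/-- Theorem 3.2: if `μ̂` is `C³` near `0` and has a zero, and `t = m/n ∈
Λ^alg(μ)` (i.e. some characteristic function `ν̂` satisfies `ν̂ⁿ = μ̂ᵐ`), then
for every zero `γ₀` of `μ̂` and every smooth path `α` through `γ₀`,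
`limsup_{s→0⁺} |μ̂(α(s))|^t / s < ∞`; hence `Λ^alg(μ) ⊆ ℚ ∩ [t₀(μ), ∞)`. -/
theorem alg_divisible_limsup_finite (μ : Measure ℝ) [IsProbabilityMeasure μ]
    (U : Set ℝ) (hU : U ∈ nhds (0 : ℝ)) (hC3 : ContDiffOn ℝ 3 (charFunR μ) U)
    (hzero : ∃ γ : ℝ, charFunR μ γ = 0)
    (m n : ℕ) (hm : 0 < m) (hn : 0 < n) (hmn : Nat.Coprime m n)
    (t : ℝ) (ht : t = (m : ℝ) / n)
    (ν : Measure ℝ) [IsProbabilityMeasure ν]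
    (hν : ∀ y, (charFunR ν y) ^ n = (charFunR μ y) ^ m) :
    ∀ γ₀ : ℝ, charFunR μ γ₀ = 0 →
      ∀ α : ℝ → ℝ, ContDiffOn ℝ (⊤ : ℕ∞) α (Set.Ioo (-1 : ℝ) 1) → α 0 = γ₀ →
        Filter.limsup (fun s : ℝ => ((‖charFunR μ (α s)‖ ^ t / s : ℝ) : EReal))
          (nhdsWithin 0 (Set.Ioi 0)) < ⊤ := by
  intro γ₀ hγ₀ α hα hα0
  have hn0 : n ≠ 0 := hn.ne'
  have hnorm (y : ℝ) : ‖charFunR μ y‖ ^ t = ‖charFunR ν y‖ := by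
    have h : ‖charFunR μ y‖ ^ m = ‖charFunR ν y‖ ^ n := by
      rw [← norm_pow, ← norm_pow, hν y]
    rw [ht, div_eq_mul_inv, Real.rpow_mul (norm_nonneg _), Real.rpow_natCast, h,
      Real.pow_rpow_inv_natCast (norm_nonneg _) hn0]
  have hνγ : charFunR ν γ₀ = 0 := by
    refine pow_eq_zero_iff hn0 |>.1 ?_
    rw [hν γ₀, hγ₀, zero_pow hm.ne']
  have hμ : ContDiffAt ℝ 2 (charFunR μ) 0 := (hC3.contDiffAt hU).of_le (by norm_num)
  have hαd : DifferentiableAt ℝ α 0 :=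
    (hα.contDiffAt (Ioo_mem_nhds (by norm_num) (by norm_num))).differentiableAt (by simp)
  have hcomp : (fun s => charFunR ν (α s)) =O[nhds 0] fun s : ℝ => s := by
    have h := (isBigO_charFunR_sub_of_pow_eq_pow μ ν hμ hn0 hν hνγ).comp_tendsto
      (hα0 ▸ hαd.continuousAt.tendsto)
    refine (h.trans ?_)
    simpa [Function.comp_def, hα0] using hαd.isBigO_sub
  obtain ⟨C, hC⟩ := hcomp.bound
  refine (Filter.limsup_le_of_le (a := (C : EReal)) (by isBoundedDefault) ?_).trans_lt
    (EReal.coe_lt_top C)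
  filter_upwards [nhdsWithin_le_nhds hC, self_mem_nhdsWithin] with s hs hs0
  rw [hnorm, EReal.coe_le_coe_iff, div_le_iff₀ hs0]
  rwa [Real.norm_of_nonneg (le_of_lt hs0)] at hs
end
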